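/- Let A be an abelian category, S a collection of objects, and suppose the smallest thick subcategory of A containing S is all of A. Then the smallest thick (triangulated, closed under direct summands) subcategory of the bounded derived category D^b(A) containing S (viewed as complexes concentrated in degree 0) is all of D^b(A). -/

import Mathlib

open CategoryTheory CategoryTheory.Limits CategoryTheory.Pretriangulated

universe w v u

variable {C : Type u} [Category.{v} C] [Abelian C]

/-- `X` is a retract (direct summand) of `B`. -/
def IsRetract {D : Type*} [Category D] (X B : D) : Prop :=
  ∃ (s : X ⟶ B) (r : B ⟶ X), s ≫ r = 𝟙 X

/-- A thick subcategory of an abelian category, given by its set of objects. -/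
structure IsThickAb (T : Set C) : Prop where
  mem_of_iso : ∀ {X Y : C}, (X ≅ Y) → X ∈ T → Y ∈ T
  zero_mem : ∀ {X : C}, IsZero X → X ∈ T
  retract_mem : ∀ {X B : C}, IsRetract X B → B ∈ T → X ∈ T
  mem₂ : ∀ (S : ShortComplex C), S.ShortExact → S.X₁ ∈ T → S.X₃ ∈ T → S.X₂ ∈ T
  mem₁ : ∀ (S : ShortComplex C), S.ShortExact → S.X₂ ∈ T → S.X₃ ∈ T → S.X₁ ∈ T
  mem₃ : ∀ (S : ShortComplex C), S.ShortExact → S.X₁ ∈ T → S.X₂ ∈ T → S.X₃ ∈ T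

/-- The smallest thick subcategory of the abelian category `C` containing `S`. -/
def thickClosure (S : Set C) : Set C :=
  {X | ∀ T : Set C, IsThickAb T → S ⊆ T → X ∈ T}

section Triangulated

variable {D : Type*} [Category D] [HasZeroObject D] [Preadditive D]
  [HasShift D ℤ] [∀ n : ℤ, (shiftFunctor D n).Additive] [Pretriangulated D]

/-- A thick (triangulated, closed under direct summands) subcategory of the full
triangulated subcategory of `D` with objects in the ambient set `A`, given by its
set of objects `T`. -/
structure IsTriThickIn (A T : Set D) : Prop where
  subset : T ⊆ A
  mem_of_iso : ∀ {X Y : D}, (X ≅ Y) → X ∈ T → Y ∈ A → Y ∈ T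
  zero_mem : ∀ {X : D}, IsZero X → X ∈ A → X ∈ T
  shift_mem : ∀ (n : ℤ) {X : D}, X ∈ T → X⟦n⟧ ∈ A → X⟦n⟧ ∈ T
  retract_mem : ∀ {X B : D}, IsRetract X B → B ∈ T → X ∈ A → X ∈ T
  mem₃ : ∀ Tr : Triangle D, Tr ∈ (distTriang D) →
    Tr.obj₁ ∈ T → Tr.obj₂ ∈ T → Tr.obj₃ ∈ A → Tr.obj₃ ∈ T

/-- The smallest thick subcategory of the full triangulated subcategory on `A`
containing `S`. -/
def triThickClosureIn (A S : Set D) : Set D :=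
  {X | ∀ T : Set D, IsTriThickIn A T → S ⊆ T → X ∈ T}

end Triangulated

variable (C) in
/-- The objects of the derived category of `C` with bounded cohomology; these are the
objects of the bounded derived category `D^b(C)`. -/
def boundedObjects [HasDerivedCategory.{w} C] : Set (DerivedCategory C) :=
  {X | ∃ a b : ℤ, ∀ n : ℤ, (n < a ∨ b < n) →
    IsZero ((DerivedCategory.homologyFunctor C n).obj X)}

open DerivedCategory in
lemma mem_bounded_iff [HasDerivedCategory.{w} C] (X : DerivedCategory C) :
    X ∈ boundedObjects C ↔ ∃ a b : ℤ, X.IsGE a ∧ X.IsLE b := by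
  simp only [isGE_iff, isLE_iff]
  constructor
  · rintro ⟨a, b, h⟩
    exact ⟨a, b, fun i hi => h i (Or.inl hi), fun i hi => h i (Or.inr hi)⟩
  · rintro ⟨a, b, h₁, h₂⟩
    exact ⟨a, b, fun i hi => hi.elim (h₁ i) (h₂ i)⟩

open DerivedCategory in
lemma single_mem_bounded [HasDerivedCategory.{w} C] (X : C) (n : ℤ) :
    (singleFunctor C n).obj X ∈ boundedObjects C :=
  (mem_bounded_iff _).2 ⟨n, n, inferInstance, inferInstance⟩

open DerivedCategory in
lemma shift_mem_bounded [HasDerivedCategory.{w} C] (X : DerivedCategory C) (n : ℤ)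
    (hX : X ∈ boundedObjects C) : X⟦n⟧ ∈ boundedObjects C := by
  rw [mem_bounded_iff] at hX ⊢
  obtain ⟨a, b, h₁, h₂⟩ := hX
  exact ⟨a - n, b - n, TStructure.t.isGE_shift X a n _ (by lia),
    TStructure.t.isLE_shift X b n _ (by lia)⟩

section
variable [HasDerivedCategory.{w} C] {T : Set (DerivedCategory C)}

open DerivedCategory

lemma tri_mem₂ (hT : IsTriThickIn (boundedObjects C) T)
    (Tr : Triangle (DerivedCategory C)) (hTr : Tr ∈ distTriang (DerivedCategory C))
    (h₁ : Tr.obj₁ ∈ T) (h₃ : Tr.obj₃ ∈ T) (h₂ : Tr.obj₂ ∈ boundedObjects C) : Tr.obj₂ ∈ T :=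
  hT.mem₃ _ (inv_rot_of_distTriang _ hTr)
    (hT.shift_mem (-1) h₃ (shift_mem_bounded _ _ (hT.subset h₃))) h₁ h₂

lemma tri_mem₁ (hT : IsTriThickIn (boundedObjects C) T)
    (Tr : Triangle (DerivedCategory C)) (hTr : Tr ∈ distTriang (DerivedCategory C))
    (h₂ : Tr.obj₂ ∈ T) (h₃ : Tr.obj₃ ∈ T) (h₁ : Tr.obj₁ ∈ boundedObjects C) : Tr.obj₁ ∈ T :=
  tri_mem₂ hT _ (inv_rot_of_distTriang _ hTr)
    (hT.shift_mem (-1) h₃ (shift_mem_bounded _ _ (hT.subset h₃))) h₂ h₁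

lemma isThickAb_preimage (hT : IsTriThickIn (boundedObjects C) T)
    : IsThickAb {X : C | (singleFunctor C 0).obj X ∈ T} where
  mem_of_iso e h := hT.mem_of_iso ((singleFunctor C 0).mapIso e) h (single_mem_bounded _ _)
  zero_mem h := hT.zero_mem ((singleFunctor C 0).map_isZero h) (single_mem_bounded _ _)
  retract_mem := by
    rintro X B ⟨s, r, h⟩ hB
    refine hT.retract_mem ⟨(singleFunctor C 0).map s, (singleFunctor C 0).map r, ?_⟩ hB
      (single_mem_bounded _ _)
    rw [← Functor.map_comp, h, CategoryTheory.Functor.map_id]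
  mem₂ S hS h₁ h₃ := tri_mem₂ hT _ hS.singleTriangle_distinguished h₁ h₃ (single_mem_bounded _ _)
  mem₁ S hS h₂ h₃ := tri_mem₁ hT _ hS.singleTriangle_distinguished h₂ h₃ (single_mem_bounded _ _)
  mem₃ S hS h₁ h₂ := hT.mem₃ _ hS.singleTriangle_distinguished h₁ h₂ (single_mem_bounded _ _)

lemma single_mem (hT : IsTriThickIn (boundedObjects C) T)
    (h : ∀ X : C, (singleFunctor C 0).obj X ∈ T) (X : C) (n : ℤ) :
    (singleFunctor C n).obj X ∈ T := by
  refine hT.mem_of_iso (((singleFunctors C).shiftIso (-n) n 0 (by lia)).app X)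
    (hT.shift_mem (-n) (h X) (shift_mem_bounded _ _ (single_mem_bounded _ _)))
    (single_mem_bounded _ _)

lemma bounded_mem (hT : IsTriThickIn (boundedObjects C) T)
    (h : ∀ X : C, (singleFunctor C 0).obj X ∈ T) (k : ℕ) :
    ∀ (b : ℤ) (X : DerivedCategory C), X.IsGE (b - k) → X.IsLE b → X ∈ T := by
  induction k with
  | zero =>
    intro b X h₁ h₂
    simp only [Nat.cast_zero, sub_zero] at h₁
    obtain ⟨Y, ⟨e⟩⟩ := exists_iso_singleFunctor_obj_of_isGE_of_isLE X b
    exact hT.mem_of_iso e.symm (single_mem hT h Y b) ((mem_bounded_iff _).2 ⟨b, b, h₁, h₂⟩)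
  | succ k ih =>
    intro b X h₁ h₂
    obtain ⟨Y, Z, hY, hZ, f, g, δ, hTr⟩ := TStructure.t.exists_triangle X (b - 1) b (by lia)
    have hY' : Y.IsLE (b - 1) := ⟨hY⟩
    have hZ' : Z.IsGE b := ⟨hZ⟩
    have hZle : Z.IsLE b := by
      rw [isLE_iff]
      intro i hi
      exact (HomologySequence.exact₃ _ hTr i (i + 1)).isZero_of_both_zeros
        ((isZero_of_isLE X b i hi).eq_of_src _ _)
        ((isZero_of_isLE Y (b - 1) (i + 1) (by lia)).eq_of_tgt _ _)
    have hYge : Y.IsGE (b - 1 - k) := by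
      rw [isGE_iff]
      intro i hi
      exact (HomologySequence.exact₁ _ hTr (i - 1) i).isZero_of_both_zeros
        ((isZero_of_isGE Z b (i - 1) (by lia)).eq_of_src _ _)
        ((isZero_of_isGE X (b - (k + 1 : ℕ)) i (by lia)).eq_of_tgt _ _)
    have hZT : Z ∈ T := by
      obtain ⟨W, ⟨e⟩⟩ := exists_iso_singleFunctor_obj_of_isGE_of_isLE Z b
      exact hT.mem_of_iso e.symm (single_mem hT h W b) ((mem_bounded_iff _).2 ⟨b, b, hZ', hZle⟩)
    exact tri_mem₂ hT _ hTr (ih _ Y hYge hY') hZT ((mem_bounded_iff _).2 ⟨_, _, h₁, h₂⟩)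

end

/-- If the smallest thick subcategory of the abelian category `C` containing a
collection of objects `S` is all of `C`, then the smallest thick subcategory of the
bounded derived category `D^b(C)` containing `S` (viewed as complexes concentrated in
degree `0`) is all of `D^b(C)`. -/
theorem triThickClosureIn_singleFunctor_image_eq [HasDerivedCategory.{w} C]
    (S : Set C) (h : thickClosure S = Set.univ) :
    triThickClosureIn (boundedObjects C)
      ((DerivedCategory.singleFunctor C 0).obj '' S) = boundedObjects C := by
  ext X
  constructor
  · intro hX
    refine hX _ ⟨subset_rfl, fun _ _ h => h, fun _ h => h, fun _ _ _ h => h, fun _ _ h => h,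
      fun _ _ _ _ h => h⟩ ?_
    rintro _ ⟨Y, -, rfl⟩
    exact single_mem_bounded _ _
  · intro hX T hT hS
    have hall : ∀ Y : C, (DerivedCategory.singleFunctor C 0).obj Y ∈ T := fun Y => by
      have hY : Y ∈ thickClosure S := h ▸ Set.mem_univ Y
      exact hY _ (isThickAb_preimage hT) (fun Z hZ => hS ⟨Z, hZ, rfl⟩)
    obtain ⟨a, b, h₁, h₂⟩ := (mem_bounded_iff X).1 hX
    exact bounded_mem hT hall (b - a).toNat b X
      (DerivedCategory.TStructure.t.isGE_of_ge X _ a (by lia)) h₂
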